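/- Let A be a Hopf algebra over k and a ⊆ A a Hopf subalgebra which is normal in A, i.e. A·a_ε = a_ε·A where a_ε = a ∩ ker(ε). Then for any left A-modules M and N, the Hopf-adjoint A-action on Hom_k(M,N) preserves the subspace Hom_a(M,N) of a-module homomorphisms, and the resulting A-action on Hom_a(M,N) annihilates the two-sided ideal (a) = A·a_ε, hence descends to an action of the quotient algebra A/(a). -/

import Mathlib

/-!
# Statement 10

Let `k` be a field and `A` a Hopf algebra over `k` with comultiplication `Δ`
(Sweedler notation `Δ(u) = Σ u₍₁₎ ⊗ u₍₂₎`), counit `ε` and antipode `S`, and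
let `a ⊆ A` (here `B : Subalgebra k A`) be a Hopf subalgebra — a subalgebra
stable under `Δ` (i.e. `Δ(B) ⊆ B ⊗ B`), `ε` and `S` — which is *normal* in
`A`, i.e. `A·a_ε = a_ε·A` where `a_ε = a ∩ ker ε`; the latter is encoded as
the equality of the left ideal `Submodule.span A a_ε` and the right ideal
`Submodule.span Aᵐᵒᵖ a_ε`.

For left `A`-modules `M` and `N`, the space `Hom_k(M, N)` is an `A`-bimodule
via `(u·f)(m) = u·(f m)` and `(f·u)(m) = f(u·m)`, and the Hopf-adjoint
`A`-action on it is `(u ▸ f)(m) = Σ u₍₁₎ · f (S(u₍₂₎) · m)` (the map `adHom`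
below); `Hom_a(M, N)` denotes the subspace of `a`-module homomorphisms (the
predicate `IsSubHom` below).

**Statement**: the Hopf-adjoint `A`-action on `Hom_k(M, N)` preserves the
subspace `Hom_a(M, N)`, and the resulting `A`-action on `Hom_a(M, N)`
annihilates the two-sided ideal `(a) = A·a_ε`, hence descends to an action of
the quotient algebra `A/(a)`.
-/

open TensorProduct

namespace Stmt10

variable {k A M N : Type*} [Field k] [Ring A] [HopfAlgebra k A]
  [AddCommGroup M] [Module k M] [Module A M] [IsScalarTower k A M]
  [AddCommGroup N] [Module k N] [Module A N] [IsScalarTower k A N]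

/-- The action of `a : A` on a module `L`, as a `k`-linear endomorphism. -/
def smulLin (L : Type*) [AddCommGroup L] [Module k L] [Module A L]
    [IsScalarTower k A L] (a : A) : L →ₗ[k] L where
  toFun x := a • x
  map_add' := smul_add a
  map_smul' c x := smul_comm a c x

lemma smulLin_add (L : Type*) [AddCommGroup L] [Module k L] [Module A L]
    [IsScalarTower k A L] (a a' : A) :
    smulLin (k := k) L (a + a') = smulLin (k := k) L a + smulLin (k := k) L a' := by
  ext x; simp [smulLin, add_smul]

lemma smulLin_smul (L : Type*) [AddCommGroup L] [Module k L] [Module A L]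
    [IsScalarTower k A L] (c : k) (a : A) :
    smulLin (k := k) L (c • a) = c • smulLin (k := k) L a := by
  ext x; simp [smulLin, smul_assoc]

/-- The Hopf-adjoint action of `u : A` on a `k`-linear map `f : M → N`:
`(u ▸ f)(m) = Σ u₍₁₎ • f (S(u₍₂₎) • m)`. -/
noncomputable def adHom (f : M →ₗ[k] N) : A →ₗ[k] (M →ₗ[k] N) :=
  (TensorProduct.lift (LinearMap.mk₂ k
      (fun u₁ u₂ => smulLin (k := k) (A := A) N u₁ ∘ₗ f ∘ₗ
        smulLin (k := k) (A := A) M (HopfAlgebra.antipode (R := k) u₂))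
      (fun u u' v => by
        simp only [smulLin_add, LinearMap.add_comp])
      (fun c u v => by
        simp only [smulLin_smul, LinearMap.smul_comp])
      (fun u v v' => by
        simp only [map_add, smulLin_add, LinearMap.comp_add])
      (fun c u v => by
        simp only [map_smul, smulLin_smul, LinearMap.comp_smul]))).comp
    (Coalgebra.comul (R := k))

/-- `f : M → N` is a homomorphism of modules over the subalgebra `B ⊆ A`. -/
def IsSubHom (B : Subalgebra k A) (f : M →ₗ[k] N) : Prop :=
  ∀ b : A, b ∈ B → ∀ m : M, f (b • m) = b • f m

lemma adHom_apply_repr {ι : Type*} (f : M →ₗ[k] N) {u : A} (r : Coalgebra.Repr k u ι) (m : M) :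
    adHom f u m =
      ∑ i ∈ r.index, r.left i • f (HopfAlgebra.antipode (R := k) (r.right i) • m) := by
  simp [adHom, smulLin, ← r.eq, map_sum]

lemma adHom_one (f : M →ₗ[k] N) : adHom f (1 : A) = f := by
  ext m
  simp [adHom, smulLin, Algebra.TensorProduct.one_def]

open scoped Coalgebra in
lemma adHom_mul (f : M →ₗ[k] N) (u v : A) : adHom f (u * v) = adHom (adHom f v) u := by
  ext m
  rw [adHom_apply_repr f ((ℛ k u).mul (ℛ k v)), adHom_apply_repr _ (ℛ k u)]
  simp only [adHom_apply_repr f (ℛ k v), Finset.smul_sum, smul_smul]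
  simp [Finset.sum_product, HopfAlgebra.antipode_mul_antidistrib, mul_smul]

/-- `Σ u₍₁₎ • f (S(u₍₂₎) u₍₃₎ • m) = u • f m`. -/
lemma sum_adHom_smul {ι : Type*} (f : M →ₗ[k] N) {u : A} (r : Coalgebra.Repr k u ι) (m : M) :
    ∑ i ∈ r.index, adHom f (r.left i) (r.right i • m) = u • f m := by
  let θ : A ⊗[k] A →ₗ[k] N := TensorProduct.lift
    ((Algebra.lsmul k k N).toLinearMap.compl₂
      (f ∘ₗ (LinearMap.toSpanSingleton A M m).restrictScalars k))
  let Φ : A ⊗[k] (A ⊗[k] A) →ₗ[k] N := θ ∘ₗ LinearMap.lTensor A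
    (LinearMap.mul' k A ∘ₗ LinearMap.rTensor A (HopfAlgebra.antipode k))
  have hΦ (x y z : A) :
      Φ (x ⊗ₜ (y ⊗ₜ z)) = x • f (HopfAlgebra.antipode k y • z • m) := by
    simp [Φ, θ, mul_smul]
  have h := congrArg Φ (Coalgebra.sum_tmul_tmul_eq r (fun i => .arbitrary k (r.left i))
    (fun i => .arbitrary k (r.right i)))
  simp only [map_sum, hΦ, ← adHom_apply_repr] at h
  rw [h]
  have hε := congrArg (θ ∘ₗ LinearMap.lTensor A (Algebra.linearMap k A))
    (Coalgebra.sum_tmul_counit_eq r)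
  simp only [LinearMap.comp_apply, map_sum, LinearMap.lTensor_tmul,
    Algebra.linearMap_apply, map_one] at hε
  simp only [← HopfAlgebra.sum_antipode_mul_eq_algebraMap_counit (.arbitrary k (r.right _)),
    TensorProduct.tmul_sum, map_sum] at hε
  simpa [θ, mul_smul] using hε

lemma exists_repr_mem {B : Subalgebra k A} {b : A}
    (hb : Coalgebra.comul (R := k) b ∈
      LinearMap.range (TensorProduct.map B.val.toLinearMap B.val.toLinearMap)) :
    ∃ r : Coalgebra.Repr k b (B × B), (∀ i, r.left i ∈ B) ∧ ∀ i, r.right i ∈ B := by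
  obtain ⟨t, ht⟩ := hb
  obtain ⟨s, rfl⟩ := TensorProduct.exists_finset t
  exact ⟨⟨s, fun p => p.1, fun p => p.2, by simpa using ht⟩, fun p => p.1.2, fun p => p.2.2⟩

/-- A homomorphism of `B`-modules is invariant under the adjoint action of `B`. -/
lemma IsSubHom.adHom_eq_counit_smul {B : Subalgebra k A} {f : M →ₗ[k] N} (hf : IsSubHom B f)
    (hantipode : ∀ b : A, b ∈ B → HopfAlgebra.antipode (R := k) b ∈ B) {b : A}
    (hb : Coalgebra.comul (R := k) b ∈
      LinearMap.range (TensorProduct.map B.val.toLinearMap B.val.toLinearMap)) :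
    adHom f b = Coalgebra.counit (R := k) b • f := by
  obtain ⟨r, -, hr⟩ := exists_repr_mem hb
  ext m
  simp only [adHom_apply_repr f r, hf _ (hantipode _ (hr _)), smul_smul, ← Finset.sum_smul,
    HopfAlgebra.sum_mul_antipode_eq_smul, smul_assoc, one_smul, LinearMap.smul_apply]

/-- A linear map invariant under the adjoint action of `B` is a homomorphism of `B`-modules. -/
lemma isSubHom_of_adHom_eq_counit_smul {B : Subalgebra k A} {f : M →ₗ[k] N}
    (hcomul : ∀ b : A, b ∈ B → Coalgebra.comul (R := k) b ∈
      LinearMap.range (TensorProduct.map B.val.toLinearMap B.val.toLinearMap))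
    (hf : ∀ b ∈ B, adHom f b = Coalgebra.counit (R := k) b • f) : IsSubHom B f := by
  intro b hb m
  obtain ⟨r, hr, -⟩ := exists_repr_mem (hcomul b hb)
  rw [← sum_adHom_smul f r m]
  simp only [hf _ (hr _), LinearMap.smul_apply, ← map_smul, ← map_sum, ← smul_assoc,
    ← Finset.sum_smul, Coalgebra.sum_counit_smul]

/-- The adjoint action of `A a_ε` annihilates the homomorphisms of `B`-modules. -/
lemma IsSubHom.adHom_eq_zero {B : Subalgebra k A} {f : M →ₗ[k] N} (hf : IsSubHom B f)
    (hcomul : ∀ b : A, b ∈ B → Coalgebra.comul (R := k) b ∈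
      LinearMap.range (TensorProduct.map B.val.toLinearMap B.val.toLinearMap))
    (hantipode : ∀ b : A, b ∈ B → HopfAlgebra.antipode (R := k) b ∈ B) {x : A}
    (hx : x ∈ Submodule.span A {x : A | x ∈ B ∧ Coalgebra.counit (R := k) x = 0}) :
    adHom f x = 0 := by
  induction hx using Submodule.span_induction with
  | mem x hx => rw [hf.adHom_eq_counit_smul hantipode (hcomul x hx.1), hx.2, zero_smul]
  | zero => exact map_zero _
  | add x y _ _ hx hy => rw [map_add, hx, hy, add_zero]
  | smul u x _ hx =>
    rw [smul_eq_mul, adHom_mul, hx]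
    ext m
    simp [adHom_apply_repr _ (Coalgebra.Repr.arbitrary k u)]

/-- For a normal Hopf subalgebra `B` of a Hopf algebra `A`
and left `A`-modules `M, N`, the Hopf-adjoint `A`-action on `Hom_k(M, N)`
preserves the subspace `Hom_a(M, N)` of `B`-module homomorphisms, and the
resulting action on `Hom_a(M, N)` annihilates the two-sided ideal
`(a) = A·a_ε`, hence descends to an action of the quotient algebra `A/(a)`. -/
theorem statement10 (B : Subalgebra k A)
    (hcomul : ∀ b : A, b ∈ B → Coalgebra.comul (R := k) b ∈
      LinearMap.range (TensorProduct.map B.val.toLinearMap B.val.toLinearMap))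
    (hantipode : ∀ b : A, b ∈ B → HopfAlgebra.antipode (R := k) b ∈ B)
    (hnorm : (Submodule.span A {x : A | x ∈ B ∧ Coalgebra.counit (R := k) x = 0} : Set A)
           = (Submodule.span Aᵐᵒᵖ {x : A | x ∈ B ∧ Coalgebra.counit (R := k) x = 0} : Set A)) :
    -- the Hopf-adjoint action preserves `Hom_a(M,N)` ...
    (∀ (u : A) (f : M →ₗ[k] N), IsSubHom B f → IsSubHom B (adHom f u)) ∧
    -- ... and the resulting action annihilates `(a) = A·a_ε`, hence descends
    --     to the quotient algebra `A/(a)`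
    (∀ x ∈ Submodule.span A {x : A | x ∈ B ∧ Coalgebra.counit (R := k) x = 0},
      ∀ f : M →ₗ[k] N, IsSubHom B f → adHom f x = 0) := by
  refine ⟨fun u f hf => isSubHom_of_adHom_eq_counit_smul hcomul fun b hb => ?_,
    fun x hx f hf => hf.adHom_eq_zero hcomul hantipode hx⟩
  have hmem : b - algebraMap k A (Coalgebra.counit b) ∈
      Submodule.span Aᵐᵒᵖ {x : A | x ∈ B ∧ Coalgebra.counit (R := k) x = 0} :=
    Submodule.subset_span ⟨B.sub_mem hb (B.algebraMap_mem _), by simp⟩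
  have hmul : (b - algebraMap k A (Coalgebra.counit b)) * u ∈
      Submodule.span A {x : A | x ∈ B ∧ Coalgebra.counit (R := k) x = 0} := by
    rw [← SetLike.mem_coe, hnorm]
    exact Submodule.smul_mem _ (MulOpposite.op u) hmem
  have h := hf.adHom_eq_zero hcomul hantipode hmul
  rwa [adHom_mul, map_sub, sub_eq_zero, Algebra.algebraMap_eq_smul_one, map_smul, adHom_one] at h

end Stmt10
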